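/- Generalized Fuglede-Putnam theorem: if T is a closed operator, M and N are unbounded normal operators with dom(N) ⊆ dom(T), then TN ⊆ MT implies TN* ⊆ M*T. -/

import Mathlib

open LinearPMap

/-- Composition of partial linear maps: `T.pcomp S` is "first `S`, then `T`", with
domain `{x ∈ dom S : S x ∈ dom T}`. -/
noncomputable def LinearPMap.pcomp {H : Type*} [NormedAddCommGroup H] [InnerProductSpace ℂ H]
    (T S : H →ₗ.[ℂ] H) : H →ₗ.[ℂ] H where
  domain := (Submodule.comap S.toFun T.domain).map S.domain.subtype
  toFun := T.toFun ∘ₗ (S.toFun.restrict fun _ hx => hx) ∘ₗ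
    (Submodule.equivMapOfInjective S.domain.subtype S.domain.injective_subtype
      (Submodule.comap S.toFun T.domain)).symm.toLinearMap

/-- A densely defined closed operator `N` on a complex Hilbert space is normal if
`N* N = N N*` (as partial linear maps). -/
noncomputable def LinearPMap.IsNormalOp {H : Type*} [NormedAddCommGroup H]
    [InnerProductSpace ℂ H] [CompleteSpace H] (N : H →ₗ.[ℂ] H) : Prop :=
  Dense (N.domain : Set H) ∧ N.IsClosed ∧ N.adjoint.pcomp N = N.pcomp N.adjoint

/-- A bounded everywhere-defined operator viewed as a partial linear map. -/
noncomputable def ContinuousLinearMap.toPMapTop {H : Type*} [NormedAddCommGroup H]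
    [InnerProductSpace ℂ H] (A : H →L[ℂ] H) : H →ₗ.[ℂ] H :=
  (A : H →ₗ[ℂ] H).toPMap ⊤

variable {H : Type*} [NormedAddCommGroup H] [InnerProductSpace ℂ H] [CompleteSpace H]

section FPHelpers

theorem fp_mem_pcomp_graph {H : Type*} [NormedAddCommGroup H] [InnerProductSpace ℂ H]
    (T S : H →ₗ.[ℂ] H) (x z : H) :
    (x, z) ∈ (T.pcomp S).graph ↔ ∃ y, (x, y) ∈ S.graph ∧ (y, z) ∈ T.graph := by
  have key : ∀ (w : S.domain) (hw : S w ∈ T.domain) (hx : (w : H) ∈ (T.pcomp S).domain),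
      (T.pcomp S) ⟨w, hx⟩ = T ⟨S w, hw⟩ := by
    intro w hw hx
    have : (Submodule.equivMapOfInjective S.domain.subtype S.domain.injective_subtype
      (Submodule.comap S.toFun T.domain)).symm ⟨(w : H), hx⟩ = ⟨w, hw⟩ := by
      rw [LinearEquiv.symm_apply_eq]
      rfl
    change T.toFun ((S.toFun.restrict fun _ hx => hx) ((Submodule.equivMapOfInjective S.domain.subtype S.domain.injective_subtype
      (Submodule.comap S.toFun T.domain)).symm ⟨(w : H), hx⟩)) = _
    rw [this]
    rfl
  constructor
  · intro h
    rw [mem_graph_iff] at h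
    obtain ⟨⟨y, hy⟩, h1, h2⟩ := h
    obtain ⟨w, hw, hwy⟩ := id hy
    simp only at h1 h2
    subst h1
    have hwy' : (w : H) = y := hwy
    subst hwy'
    have hw' : S w ∈ T.domain := hw
    refine ⟨S w, mem_graph _ _, ?_⟩
    rw [← h2, key w hw' hy]
    exact mem_graph T ⟨S w, hw'⟩
  · rintro ⟨y, h1, h2⟩
    rw [mem_graph_iff] at h1 h2
    obtain ⟨w, hw1, hw2⟩ := h1
    obtain ⟨v, hv1, hv2⟩ := h2
    simp only at hw1 hw2 hv1 hv2
    subst hw1 hv2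
    have hv : S w ∈ T.domain := by rw [hw2, ← hv1]; exact v.2
    have hx : (w : H) ∈ (T.pcomp S).domain := ⟨w, hv, rfl⟩
    rw [mem_graph_iff]
    refine ⟨⟨w, hx⟩, rfl, ?_⟩
    simp only
    rw [key w hv hx]
    congr 1
    ext
    simp [hw2, hv1]

theorem fp_cutoff {𝒜 : Type*} [CStarAlgebra 𝒜] (R : 𝒜) (hR : IsSelfAdjoint R)
    (hpos : ∀ t ∈ spectrum ℝ R, 0 ≤ t) (ε : ℝ) (hε : 0 < ε) :
    ∃ P h : 𝒜, IsSelfAdjoint P ∧ IsSelfAdjoint h ∧ R * h * P = P ∧ ‖P - R‖ ≤ ε ∧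
      (∀ b, Commute R b → Commute P b) ∧ (∀ b, Commute R b → Commute h b) := by
  have c1 : Continuous (fun t : ℝ => max 0 (t - ε)) := by fun_prop
  have c2 : Continuous (fun t : ℝ => (max t ε)⁻¹) := by
    apply Continuous.inv₀ (by fun_prop)
    intro t
    have : ε ≤ max t ε := le_max_right _ _
    linarith
  refine ⟨cfc (fun t : ℝ => max 0 (t - ε)) R, cfc (fun t : ℝ => (max t ε)⁻¹) R,
    cfc_predicate _ _, cfc_predicate _ _, ?_, ?_, fun b hb => hb.cfc_real _, fun b hb => hb.cfc_real _⟩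
  · conv_lhs => rw [← cfc_id' ℝ R]
    rw [cfc_id' ℝ R]
    nth_rewrite 1 [← cfc_id' ℝ R]
    rw [← cfc_mul _ _ R (by fun_prop) c2.continuousOn,
      ← cfc_mul _ _ R (by exact (continuous_id.mul c2).continuousOn) c1.continuousOn]
    apply cfc_congr
    intro t ht
    simp only
    rcases le_total t ε with h | h
    · simp [max_eq_left (sub_nonpos.2 h)]
    · rw [max_eq_left h, mul_inv_cancel₀ (by linarith), one_mul]
  · nth_rewrite 2 [← cfc_id' ℝ R]
    rw [← cfc_sub _ _ R c1.continuousOn (by fun_prop)]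
    apply norm_cfc_le hε.le
    intro t ht
    have := hpos t ht
    rw [Real.norm_eq_abs, abs_le]
    rcases le_total t ε with h | h
    · rw [max_eq_left (sub_nonpos.2 h)]; constructor <;> linarith
    · rw [max_eq_right (sub_nonneg.2 h)]; constructor <;> linarith

theorem fp_bounded {𝒜 : Type*} [CStarAlgebra 𝒜] (R S B D A : 𝒜)
    (hR : IsSelfAdjoint R) (hS : IsSelfAdjoint S)
    (hRp : ∀ t ∈ spectrum ℝ R, 0 ≤ t) (hSp : ∀ t ∈ spectrum ℝ S, 0 ≤ t)
    (hB : star B * B = B * star B) (hD : star D * D = D * star D)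
    (hRB : Commute R B) (hSD : Commute S D)
    (h : D * A * R = S * A * B) :
    S * (star D * A * R - S * A * star B) * R = 0 := by
  set X := star D * A * R - S * A * star B with hX
  have hRB' : Commute R (star B) := by
    have := hRB.star_star; rwa [hR.star_eq] at this
  have hSD' : Commute S (star D) := by
    have := hSD.star_star; rwa [hS.star_eq] at this
  have key : ∀ ε : ℝ, 0 < ε → ∃ P Q : 𝒜, ‖P - R‖ ≤ ε ∧ ‖Q - S‖ ≤ ε ∧ Q * X * P = 0 := by
    intro ε hε
    obtain ⟨P, k, hP, hk, hPk, hPn, hPc, hkc⟩ := fp_cutoff R hR hRp ε hε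
    obtain ⟨Q, l, hQ, hl, hQl, hQn, hQc, hlc⟩ := fp_cutoff S hS hSp ε hε
    refine ⟨P, Q, hPn, hQn, ?_⟩
    have PR : Commute P R := hPc R (Commute.refl R)
    have kR : Commute k R := hkc R (Commute.refl R)
    have kP : Commute k P := hkc P PR.symm
    have QS : Commute Q S := hQc S (Commute.refl S)
    have lS : Commute l S := hlc S (Commute.refl S)
    have lQ : Commute l Q := hlc Q QS.symm
    have nk : IsStarNormal (B * k) := by
      constructor
      have h1 := (hkc B hRB).eq
      have h2 := (hkc _ hRB').eq
      rw [star_mul, hk.star_eq]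
      change k * star B * (B * k) = B * k * (k * star B)
      calc k * star B * (B * k) = k * (star B * B) * k := by noncomm_ring
        _ = (k * B) * (star B * k) := by rw [hB]; noncomm_ring
        _ = _ := by rw [h1, ← h2]
    have nl : IsStarNormal (D * l) := by
      constructor
      have h1 := (hlc D hSD).eq
      have h2 := (hlc _ hSD').eq
      rw [star_mul, hl.star_eq]
      change l * star D * (D * l) = D * l * (l * star D)
      calc l * star D * (D * l) = l * (star D * D) * l := by noncomm_ring
        _ = (l * D) * (star D * l) := by rw [hD]; noncomm_ring
        _ = _ := by rw [h1, ← h2]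
    have e1 : ∀ b, Commute R b → P * R * (b * k) = b * P := by
      intro b hb
      calc P * R * (b * k) = P * (R * b) * k := by noncomm_ring
        _ = P * b * (R * k) := by rw [hb.eq]; noncomm_ring
        _ = b * (P * (R * k)) := by rw [(hPc b hb).eq]; noncomm_ring
        _ = b * (R * k * P) := by rw [(PR.mul_right kP.symm).eq]
        _ = b * P := by rw [hPk]
    have e2 : ∀ b, Commute S b → (b * l) * (S * Q) = Q * b := by
      intro b hb
      calc (b * l) * (S * Q) = b * (l * S) * Q := by noncomm_ring
        _ = b * (S * l * Q) := by rw [lS.eq]; noncomm_ring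
        _ = Q * b := by rw [hQl, (hQc b hb).eq]
    have hs : SemiconjBy (Q * S * A * R * P) (B * k) (D * l) := by
      have a1 : Q * S * A * R * P * (B * k) = Q * (S * A * B) * P := by
        rw [mul_assoc (Q * S * A), ← PR.eq, mul_assoc (Q * S * A), e1 B hRB]; noncomm_ring
      have a2 : D * l * (Q * S * A * R * P) = Q * (D * A * R) * P := by
        calc _ = (D * l) * (Q * S) * A * R * P := by noncomm_ring
          _ = _ := by rw [QS.eq, e2 D hSD]; noncomm_ring
      change _ = _
      rw [a1, a2, h]
    have hs' := (hs.star_right nk nl).eq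
    have f1 : star (B * k) = star B * k := by
      rw [star_mul, hk.star_eq, (hkc _ hRB').eq]
    have f2 : star (D * l) = star D * l := by
      rw [star_mul, hl.star_eq, (hlc _ hSD').eq]
    rw [f1, f2] at hs'
    have a1 : Q * S * A * R * P * (star B * k) = Q * (S * A * star B) * P := by
      rw [mul_assoc (Q * S * A), ← PR.eq, mul_assoc (Q * S * A), e1 _ hRB']; noncomm_ring
    have a2 : star D * l * (Q * S * A * R * P) = Q * (star D * A * R) * P := by
      calc _ = (star D * l) * (Q * S) * A * R * P := by noncomm_ring
        _ = _ := by rw [QS.eq, e2 _ hSD']; noncomm_ring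
    rw [a1, a2] at hs'
    rw [hX, mul_sub, sub_mul, hs', sub_self]
  choose! P Q hP hQ hPQ using key
  have lP : Filter.Tendsto (fun n : ℕ => P (1 / ((n : ℝ) + 1))) Filter.atTop (nhds R) := by
    rw [tendsto_iff_norm_sub_tendsto_zero]
    exact squeeze_zero (fun _ => norm_nonneg _) (fun n => hP _ (by positivity))
      tendsto_one_div_add_atTop_nhds_zero_nat
  have lQ : Filter.Tendsto (fun n : ℕ => Q (1 / ((n : ℝ) + 1))) Filter.atTop (nhds S) := by
    rw [tendsto_iff_norm_sub_tendsto_zero]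
    exact squeeze_zero (fun _ => norm_nonneg _) (fun n => hQ _ (by positivity))
      tendsto_one_div_add_atTop_nhds_zero_nat
  have l3 := (lQ.mul_const X).mul lP
  refine tendsto_nhds_unique l3 ?_
  refine tendsto_const_nhds.congr fun n => ?_
  exact (hPQ _ (by positivity)).symm

end FPHelpers

section FPHelpers2


theorem fp_mem_adj {N : H →ₗ.[ℂ] H} (hd : Dense (N.domain : Set H)) (u v : H) :
    (u, v) ∈ N.adjoint.graph ↔ ∀ a b, (a, b) ∈ N.graph → (inner ℂ (b) (u)) = (inner ℂ (a) (v)) := by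
  rw [LinearPMap.adjoint_graph_eq_graph_adjoint hd, Submodule.mem_adjoint_iff]
  simp only [sub_eq_zero]

theorem fp_resolvent {N : H →ₗ.[ℂ] H} (hd : Dense (N.domain : Set H)) (hc : N.IsClosed) :
    ∃ R B : H →L[ℂ] H, ∀ y, (R y, B y) ∈ N.graph ∧ (B y, y - R y) ∈ N.adjoint.graph := by
  let e := WithLp.prodContinuousLinearEquiv 2 ℂ H H
  let G : Submodule ℂ (WithLp 2 (H × H)) := N.graph.comap (e : WithLp 2 (H × H) →ₗ[ℂ] H × H)
  have hG : IsClosed (G : Set (WithLp 2 (H × H))) := hc.preimage e.continuous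
  have : CompleteSpace G := hG.completeSpace_coe
  let P : H →L[ℂ] WithLp 2 (H × H) :=
    G.starProjection ∘L (e.symm : H × H →L[ℂ] WithLp 2 (H × H)) ∘L ContinuousLinearMap.inl ℂ H H
  let Q : H →L[ℂ] H × H := (e : WithLp 2 (H × H) →L[ℂ] H × H) ∘L P
  refine ⟨ContinuousLinearMap.fst ℂ H H ∘L Q, ContinuousLinearMap.snd ℂ H H ∘L Q, fun y => ?_⟩
  have h1 : P y ∈ G := Submodule.starProjection_apply_mem G _
  have h1' : ((P y).fst, (P y).snd) ∈ N.graph := h1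
  refine ⟨h1', ?_⟩
  rw [fp_mem_adj hd]
  intro a b hab
  have h2 : e.symm (y, 0) - P y ∈ Gᗮ := Submodule.sub_starProjection_mem_orthogonal _
  have h3 := (Submodule.mem_orthogonal _ _).1 h2 (e.symm (a, b)) hab
  rw [WithLp.prod_inner_apply] at h3
  have h4 : (inner ℂ (a) (y - (P y).fst)) + (inner ℂ (b) (0 - (P y).snd)) = 0 := h3
  change (inner ℂ (b) ((P y).snd)) = (inner ℂ (a) (y - (P y).fst))
  rw [zero_sub, inner_neg_right] at h4
  linear_combination -h4

theorem fp_closed_comp {T : H →ₗ.[ℂ] H} (hc : T.IsClosed) (R : H →L[ℂ] H)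
    (hR : ∀ y, R y ∈ T.domain) : ∃ A : H →L[ℂ] H, ∀ y, (R y, A y) ∈ T.graph := by
  let A : H →ₗ[ℂ] H := T.toFun ∘ₗ (R : H →ₗ[ℂ] H).codRestrict T.domain hR
  have hA : ∀ y, (R y, A y) ∈ T.graph := fun y => mem_graph T ⟨R y, hR y⟩
  have hg : IsClosed (A.graph : Set (H × H)) := by
    have : (A.graph : Set (H × H)) = (fun p : H × H => (R p.1, p.2)) ⁻¹' (T.graph : Set (H × H)) := by
      ext ⟨x, y⟩
      simp only [SetLike.mem_coe, LinearMap.mem_graph_iff, Set.mem_preimage]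
      constructor
      · rintro rfl; exact hA x
      · intro h; exact LinearPMap.mem_graph_snd_inj T h (hA x) rfl
    rw [this]
    exact IsClosed.preimage (by fun_prop) hc
  exact ⟨ContinuousLinearMap.ofIsClosedGraph hg, fun y => hA y⟩

/-- The data attached to a normal operator. -/
structure FPData (N : H →ₗ.[ℂ] H) (R B : H →L[ℂ] H) : Prop where
  sa : IsSelfAdjoint R
  pos : ∀ t ∈ spectrum ℝ R, 0 ≤ t
  inj : ∀ x, R x = 0 → x = 0
  comm : ∀ x, R (B x) = B (R x)
  normal : star B * B = B * star B
  sq : ∀ x, star B (B x) = R (x - R x)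
  sq' : ∀ x, B (star B x) = R (x - R x)
  g1 : ∀ y, (R y, B y) ∈ N.graph
  g2 : ∀ y, (B y, y - R y) ∈ N.adjoint.graph
  g3 : ∀ y, (R y, star B y) ∈ N.adjoint.graph
  g4 : ∀ y, (star B y, y - R y) ∈ N.graph
  c1 : ∀ z z', (z, z') ∈ N.graph → B z = R z'
  c2 : ∀ z z', (z, z') ∈ N.adjoint.graph → star B z = R z'

theorem fp_data {N : H →ₗ.[ℂ] H} (hN : N.IsNormalOp) : ∃ R B : H →L[ℂ] H, FPData N R B := by
  obtain ⟨hd, hc, hn⟩ := hN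
  obtain ⟨R, B, hRB⟩ := fp_resolvent hd hc
  have g1 : ∀ y, (R y, B y) ∈ N.graph := fun y => (hRB y).1
  have g2 : ∀ y, (B y, y - R y) ∈ N.adjoint.graph := fun y => (hRB y).2
  have adj : ∀ {a b u v}, (a, b) ∈ N.graph → (u, v) ∈ N.adjoint.graph → (inner ℂ (b) (u)) = (inner ℂ (a) (v)) :=
    fun h1 h2 => (fp_mem_adj hd _ _).1 h2 _ _ h1
  have nrm : ∀ x y, (∃ w, (x, w) ∈ N.graph ∧ (w, y) ∈ N.adjoint.graph) →
      ∃ w, (x, w) ∈ N.adjoint.graph ∧ (w, y) ∈ N.graph := by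
    intro x y h
    rw [← fp_mem_pcomp_graph] at h ⊢
    rwa [← hn]
  have uniq : ∀ v w z, (v, w) ∈ N.graph → (w, z - v) ∈ N.adjoint.graph → v = R z ∧ w = B z := by
    intro v w z h1 h2
    have h3 : (v - R z, w - B z) ∈ N.graph := N.graph.sub_mem h1 (g1 z)
    have h4 : (w - B z, (z - v) - (z - R z)) ∈ N.adjoint.graph := N.adjoint.graph.sub_mem h2 (g2 z)
    have h5 := adj h3 h4
    have e : (z - v) - (z - R z) = -(v - R z) := by abel
    rw [e, inner_neg_right, inner_self_eq_norm_sq_to_K, inner_self_eq_norm_sq_to_K] at h5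
    have h6 : ‖w - B z‖ ^ 2 = -‖v - R z‖ ^ 2 := by exact_mod_cast h5
    have h7 : ‖w - B z‖ = 0 := by
      have := sq_nonneg ‖v - R z‖
      have := sq_nonneg ‖w - B z‖
      exact pow_eq_zero_iff (two_ne_zero) |>.1 (by linarith)
    have h8 : ‖v - R z‖ = 0 := by
      have := sq_nonneg ‖v - R z‖
      have := sq_nonneg ‖w - B z‖
      exact pow_eq_zero_iff (two_ne_zero) |>.1 (by linarith)
    exact ⟨sub_eq_zero.1 (norm_eq_zero.1 h8), sub_eq_zero.1 (norm_eq_zero.1 h7)⟩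
  have quad : ∀ y z, (inner ℂ (R y) (z)) = (inner ℂ (R y) (R z)) + (inner ℂ (B y) (B z)) := by
    intro y z
    rw [adj (g1 y) (g2 z), inner_sub_right]; ring
  have sym : ∀ y z, (inner ℂ (R y) (z)) = (inner ℂ (y) (R z)) := by
    intro y z
    rw [quad y z, ← inner_conj_symm y (R z), quad z y, _root_.map_add, inner_conj_symm, inner_conj_symm]
  have hpos : R.IsPositive := by
    rw [ContinuousLinearMap.isPositive_def]
    refine ⟨fun x y => sym x y, fun x => ?_⟩
    rw [ContinuousLinearMap.reApplyInnerSelf_apply, quad, _root_.map_add]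
    exact add_nonneg inner_self_nonneg inner_self_nonneg
  have sa : IsSelfAdjoint R := hpos.isSelfAdjoint
  have inj : ∀ x, R x = 0 → x = 0 := by
    intro x hx
    have h1 := g1 x
    rw [hx] at h1
    have h2 : B x = 0 := LinearPMap.graph_fst_eq_zero_snd N h1 rfl
    have h3 := g2 x
    rw [h2, hx, sub_zero] at h3
    exact LinearPMap.graph_fst_eq_zero_snd _ h3 rfl
  have c2 : ∀ z z', (z, z') ∈ N.adjoint.graph → star B z = R z' := by
    intro z z' h
    apply ext_inner_left ℂ
    intro v
    rw [ContinuousLinearMap.star_eq_adjoint, ContinuousLinearMap.adjoint_inner_right, adj (g1 v) h, sym]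
  have c1 : ∀ z z', (z, z') ∈ N.graph → B z = R z' := by
    intro z z' h
    obtain ⟨w, hw1, hw2⟩ := nrm (R z') (z' - R z') ⟨_, g1 z', g2 z'⟩
    have h1 : (z - w, z' - (z' - R z')) ∈ N.graph := N.graph.sub_mem h hw2
    rw [sub_sub_cancel] at h1
    refine (uniq (z - w) (R z') z h1 ?_).2.symm
    rwa [sub_sub_cancel]
  have comm : ∀ x, R (B x) = B (R x) := fun x => (c1 _ _ (g1 x)).symm
  have g34 : ∀ y, (R y, star B y) ∈ N.adjoint.graph ∧ (star B y, y - R y) ∈ N.graph := by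
    intro y
    obtain ⟨w, hw1, hw2⟩ := nrm (R y) (y - R y) ⟨_, g1 y, g2 y⟩
    have : w = star B y := by
      apply hd.eq_of_inner_right ℂ
      intro a ha
      have h1 : (a, N ⟨a, ha⟩) ∈ N.graph := mem_graph N ⟨a, ha⟩
      rw [ContinuousLinearMap.star_eq_adjoint, ContinuousLinearMap.adjoint_inner_right, ← adj h1 hw1,
        c1 _ _ h1, sym]
    rw [← this]
    exact ⟨hw1, hw2⟩
  have sq : ∀ x, star B (B x) = R (x - R x) := fun x => c2 _ _ (g2 x)
  have sq' : ∀ x, B (star B x) = R (x - R x) := fun x => c1 _ _ (g34 x).2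
  refine ⟨R, B, sa, ?_, inj, comm, ?_, sq, sq', g1, g2, fun y => (g34 y).1, fun y => (g34 y).2, c1, c2⟩
  · have : 0 ≤ R := (ContinuousLinearMap.nonneg_iff_isPositive R).2 hpos
    exact fun t ht => spectrum_nonneg_of_nonneg this ht
  · ext x
    change star B (B x) = B (star B x)
    rw [sq, sq']

theorem FPData.mem_adj {N : H →ₗ.[ℂ] H} {R B : H →L[ℂ] H} (D : FPData N R B) (v w : H)
    (h : R w = star B v) : (v, w) ∈ N.adjoint.graph := by
  have h1 := D.g4 v
  rw [← h] at h1
  have h2 : B w = v - R v := LinearPMap.mem_graph_snd_inj N (D.g1 w) h1 rfl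
  have h3 := N.adjoint.graph.add_mem (D.g2 w) (D.g3 v)
  rw [h2, ← h] at h3
  simpa using h3

theorem FPData.dom {N : H →ₗ.[ℂ] H} {R B : H →L[ℂ] H} (D : FPData N R B)
    (hd : Dense (N.domain : Set H)) (hc : N.IsClosed) (x x' : H)
    (h : (x, x') ∈ N.adjoint.graph) : x ∈ N.domain := by
  let e := WithLp.prodContinuousLinearEquiv 2 ℂ H H
  let L : H →ₗ[ℂ] WithLp 2 (H × H) :=
    ((e.symm : H × H →L[ℂ] WithLp 2 (H × H)) ∘L (R.prod (star B)) : H →L[ℂ] WithLp 2 (H × H))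
  let K : Submodule ℂ (WithLp 2 (H × H)) := (LinearMap.range L).topologicalClosure
  have hK : IsClosed (K : Set (WithLp 2 (H × H))) := Submodule.isClosed_topologicalClosure _
  have : CompleteSpace K := hK.completeSpace_coe
  let G : Submodule ℂ (WithLp 2 (H × H)) :=
    N.adjoint.graph.comap (e : WithLp 2 (H × H) →ₗ[ℂ] H × H)
  have hG : IsClosed (G : Set (WithLp 2 (H × H))) :=
    (LinearPMap.adjoint_isClosed hd).preimage e.continuous
  have hKG : K ≤ G := by
    apply Submodule.topologicalClosure_minimal _ _ hG
    rintro _ ⟨z, rfl⟩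
    exact D.g3 z
  let p := e.symm (x, x')
  let q := K.starProjection p
  have hq : q ∈ K := Submodule.starProjection_apply_mem K _
  have hpq : p - q ∈ Kᗮ := Submodule.sub_starProjection_mem_orthogonal _
  have hG' : p - q ∈ G := G.sub_mem h (hKG hq)
  set d := p - q with hdef
  have hdG : (d.fst, d.snd) ∈ N.adjoint.graph := hG'
  have h1 : R d.snd = star B d.fst := (D.c2 _ _ hdG).symm
  have h2 : B d.snd = d.fst - R d.fst := by
    have h1' := D.g4 d.fst
    rw [← h1] at h1'
    exact LinearPMap.mem_graph_snd_inj N (D.g1 d.snd) h1' rfl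
  have h3 : d.fst = 0 := by
    apply ext_inner_left ℂ
    intro z
    have h4 := (Submodule.mem_orthogonal _ _).1 hpq (L z)
      (Submodule.le_topologicalClosure _ ⟨z, rfl⟩)
    rw [WithLp.prod_inner_apply] at h4
    have h5 : (inner ℂ (R z) (d.fst)) + (inner ℂ (star B z) (d.snd)) = 0 := h4
    rw [ContinuousLinearMap.star_eq_adjoint, ContinuousLinearMap.adjoint_inner_left, h2,
      ← ContinuousLinearMap.adjoint_inner_right, ← ContinuousLinearMap.star_eq_adjoint,
      D.sa.star_eq, ← inner_add_right] at h5
    simpa using h5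
  have h4 : d.snd = 0 := LinearPMap.graph_fst_eq_zero_snd _ hdG h3
  have h5 : p ∈ K := by
    have : d = 0 := by
      apply e.injective
      exact Prod.ext h3 h4
    rw [sub_eq_zero.1 (hdef.symm.trans this)]
    exact hq
  have h6 : p ∈ closure (Set.range L) := h5
  obtain ⟨s, hs1, hs2⟩ := mem_closure_iff_seq_limit.1 h6
  choose z hz using hs1
  have hs3 : Filter.Tendsto (fun n => e (s n)) Filter.atTop (nhds (x, x')) := by
    have := (e.continuous.tendsto p).comp hs2
    exact this
  have hs4 : ∀ n, e (s n) = (R (z n), star B (z n)) := by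
    intro n; rw [← hz n]; rfl
  simp only [hs4] at hs3
  have t1 : Filter.Tendsto (fun n => R (z n)) Filter.atTop (nhds x) :=
    (continuous_fst.tendsto _).comp hs3
  have t2 : Filter.Tendsto (fun n => star B (z n)) Filter.atTop (nhds x') :=
    (continuous_snd.tendsto _).comp hs3
  have hnorm : ∀ y, ‖B y‖ = ‖star B y‖ := by
    intro y
    have e1 : (inner ℂ (B y) (B y)) = (inner ℂ (star B y) (star B y)) := by
      rw [ContinuousLinearMap.star_eq_adjoint, ContinuousLinearMap.adjoint_inner_left,
        ← ContinuousLinearMap.adjoint_inner_right, ← ContinuousLinearMap.star_eq_adjoint,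
        D.sq, D.sq']
    rw [inner_self_eq_norm_sq_to_K, inner_self_eq_norm_sq_to_K] at e1
    have e2 : ‖B y‖ ^ 2 = ‖star B y‖ ^ 2 := by exact_mod_cast e1
    exact (sq_eq_sq₀ (norm_nonneg _) (norm_nonneg _)).1 e2
  have hcau : CauchySeq (fun n => B (z n)) := by
    have := t2.cauchySeq
    rw [Metric.cauchySeq_iff] at this ⊢
    intro ε hε
    obtain ⟨n, hn⟩ := this ε hε
    refine ⟨n, fun a ha b hb => ?_⟩
    have := hn a ha b hb
    rwa [dist_eq_norm, ← _root_.map_sub, ← hnorm, _root_.map_sub, ← dist_eq_norm] at this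
  obtain ⟨y, hy⟩ := cauchySeq_tendsto_of_complete hcau
  have : (x, y) ∈ N.graph :=
    IsClosed.mem_of_tendsto hc (t1.prodMk_nhds hy) (Filter.Eventually.of_forall fun n => D.g1 (z n))
  exact LinearPMap.mem_domain_of_mem_graph this

end FPHelpers2

/-- **Generalized Fuglede–Putnam theorem.** If `T` is a closed operator and `M, N` are
unbounded normal operators with `dom N ⊆ dom T`, then `T N ⊆ M T` implies `T N* ⊆ M* T`. -/
theorem fuglede_putnam_closed (T N M : H →ₗ.[ℂ] H)
    (hTc : T.IsClosed) (hTd : Dense (T.domain : Set H))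
    (hN : N.IsNormalOp) (hM : M.IsNormalOp)
    (hdom : N.domain ≤ T.domain)
    (h : T.pcomp N ≤ M.pcomp T) :
    T.pcomp N.adjoint ≤ M.adjoint.pcomp T := by
  obtain ⟨R, B, dN⟩ := fp_data hN
  obtain ⟨S, D, dM⟩ := fp_data hM
  have hyp : ∀ x y z, (x, y) ∈ N.graph → (y, z) ∈ T.graph →
      ∃ w, (x, w) ∈ T.graph ∧ (w, z) ∈ M.graph := by
    intro x y z h1 h2
    exact (fp_mem_pcomp_graph _ _ _ _).1
      (LinearPMap.le_graph_of_le h ((fp_mem_pcomp_graph _ _ _ _).2 ⟨y, h1, h2⟩))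
  have Tu : ∀ {x y z}, (x, y) ∈ T.graph → (x, z) ∈ T.graph → y = z :=
    fun h1 h2 => LinearPMap.mem_graph_snd_inj T h1 h2 rfl
  obtain ⟨A, hA⟩ := fp_closed_comp hTc R
    (fun y => hdom (LinearPMap.mem_domain_of_mem_graph (dN.g1 y)))
  obtain ⟨A', hA'⟩ := fp_closed_comp hTc (star B)
    (fun y => hdom (LinearPMap.mem_domain_of_mem_graph (dN.g4 y)))
  have injS : ∀ x y, S x = S y → x = y := by
    intro x y hxy
    exact sub_eq_zero.1 (dM.inj _ (by rw [_root_.map_sub, hxy, sub_self]))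
  -- cancellation of `R` on the right
  have canc : ∀ X : H →L[ℂ] H, X * R = 0 → X = 0 := by
    intro X hX
    have h1 : R * star X = 0 := by
      have := congrArg star hX
      rwa [star_mul, dN.sa.star_eq, star_zero] at this
    have h2 : star X = 0 := by
      ext y
      exact dN.inj _ (by simpa using congrArg (fun F : H →L[ℂ] H => F y) h1)
    simpa using h2
  have cR : Commute R B := by ext x; exact dN.comm x
  have cS : Commute S D := by ext x; exact dM.comm x
  have cR' : Commute R (star B) := by
    have := cR.star_star; rwa [dN.sa.star_eq] at this
  have cS' : Commute S (star D) := by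
    have := cS.star_star; rwa [dM.sa.star_eq] at this
  have comR' : ∀ x, R (star B x) = star B (R x) :=
    fun x => congrArg (fun F : H →L[ℂ] H => F x) cR'.eq
  have comS' : ∀ x, S (star D x) = star D (S x) :=
    fun x => congrArg (fun F : H →L[ℂ] H => F x) cS'.eq
  have E1 : ∀ y, D (A (R y)) = S (A (B y)) := by
    intro y
    have h1 : (R (R y), R (B y)) ∈ N.graph := by rw [dN.comm]; exact dN.g1 (R y)
    obtain ⟨w, hw1, hw2⟩ := hyp _ _ _ h1 (hA (B y))
    rw [Tu hw1 (hA (R y))] at hw2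
    exact dM.c1 _ _ hw2
  have E2 : ∀ y, star D (A (R y)) = S (A (star B y)) := by
    have h1 := fp_bounded R S B D A dN.sa dM.sa dN.pos dM.pos dN.normal dM.normal cR cS
      (by ext y; exact E1 y)
    have h2 := canc _ h1
    intro y
    have h3 := congrArg (fun F : H →L[ℂ] H => F y) h2
    have h4 : S (star D (A (R y)) - S (A (star B y))) = 0 := h3
    exact sub_eq_zero.1 (dM.inj _ h4)
  -- S A' = D* A
  have E5 : ∀ y, S (A' y) = star D (A y) := by
    have h1 : (S * A' - star D * A) * R = 0 := by
      ext y
      change S (A' (R y)) - star D (A (R y)) = 0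
      have h2 : A' (R y) = A (star B y) := by
        apply Tu (hA' (R y))
        rw [← comR']
        exact hA _
      rw [h2, E2, sub_self]
    intro y
    exact sub_eq_zero.1 (congrArg (fun F : H →L[ℂ] H => F y) (canc _ h1))
  -- S T ⊆ T R
  have E3 : ∀ y t, (y, t) ∈ T.graph → S t = A y := by
    intro y t hy
    have h1 : (y - R y, t - A y) ∈ T.graph := T.graph.sub_mem hy (hA y)
    obtain ⟨w, hw1, hw2⟩ := hyp _ _ _ (dN.g4 y) h1
    rw [Tu hw1 (hA' y)] at hw2
    have h2 := dM.c1 _ _ hw2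
    apply injS
    have h3 : S (S (t - A y)) = S (A y - S (A y)) := by
      rw [← h2, dM.comm, E5, dM.sq']
    simp only [_root_.map_sub] at h3
    exact sub_left_inj.1 h3
  apply LinearPMap.le_of_le_graph
  rintro ⟨x, t⟩ hx
  rw [fp_mem_pcomp_graph] at hx ⊢
  obtain ⟨y, hy1, hy2⟩ := hx
  have hxT : x ∈ T.domain := hdom (dN.dom hN.1 hN.2.1 x y hy1)
  have hx2 : (x, T ⟨x, hxT⟩) ∈ T.graph := mem_graph T ⟨x, hxT⟩
  refine ⟨_, hx2, ?_⟩
  apply dM.mem_adj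
  apply injS
  have h1 : A y = A' x := by
    apply Tu (hA y)
    rw [← dN.c2 _ _ hy1]
    exact hA' x
  rw [E3 _ _ hy2, h1, E5, comS', E3 _ _ hx2]
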